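/- For every run of the modified greedy algorithm, every OPT ⊆ V with c(OPT) ≤ b, and every real α⊥ with 0.405 < α⊥ < 1 and (1−α⊥)·ln(1−α⊥) + (2 − 1/e)·(1 − 2·α⊥) = 0, it holds that f(S_m) ≥ α⊥ · f(OPT), i.e., max (f S_g) (max_{v ∈ V} f {v}) ≥ α⊥ · f(OPT). -/

import Mathlib

open Finset

/-! ### Exponential growth of sequences -/

lemma sub_le_mul_exp_neg_of_gain {F x g a Y : ℝ} (hY : 0 ≤ Y) (hx : F - x ≤ Y) (hg : 0 ≤ g)
    (hga : a * (F - x) ≤ g) : F - (x + g) ≤ Y * Real.exp (-a) := by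
  have he : 1 - a ≤ Real.exp (-a) := by linarith [Real.add_one_le_exp (-a)]
  rcases le_total (F - x) 0 with h | h
  · have := mul_nonneg hY (Real.exp_pos (-a)).le
    linarith
  · calc F - (x + g) ≤ (1 - a) * (F - x) := by linarith
      _ ≤ Real.exp (-a) * (F - x) := mul_le_mul_of_nonneg_right he h
      _ ≤ Real.exp (-a) * Y := mul_le_mul_of_nonneg_left hx (Real.exp_pos _).le
      _ = Y * Real.exp (-a) := mul_comm _ _

lemma sub_le_mul_exp_neg_of_rate {x t : ℕ → ℝ} {F w Y : ℝ} {m n : ℕ} (hmn : m ≤ n) (hY : 0 ≤ Y)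
    (hx : F - x m ≤ Y) (hmono : ∀ i < n, x i ≤ x (i + 1))
    (hrate : ∀ i < n, (t (i + 1) - t i) / w * (F - x i) ≤ x (i + 1) - x i) :
    F - x n ≤ Y * Real.exp (-((t n - t m) / w)) := by
  induction n, hmn using Nat.le_induction with
  | base => simpa using hx
  | succ n _ ih =>
    have h := ih (fun i hi => hmono i (by omega)) (fun i hi => hrate i (by omega))
    have h' := sub_le_mul_exp_neg_of_gain (mul_nonneg hY (Real.exp_pos _).le) h
      (sub_nonneg.2 (hmono n n.lt_succ_self)) (hrate n n.lt_succ_self)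
    rw [mul_assoc, ← Real.exp_add] at h'
    convert h' using 2
    · ring
    · ring_nf

/-- A sequence growing both towards `G` at rate `1 / r` and towards `F` at rate `1 / w`: use the
first rate up to time `r` and the second one afterwards. -/
lemma sub_le_mul_exp_neg_of_two_rates {x t : ℕ → ℝ} {F G r w : ℝ} {n : ℕ}
    (hx0 : x 0 = 0) (ht0 : t 0 = 0) (hr : 0 < r) (hrn : r ≤ t n) (hG : 0 ≤ G) (hGF : G ≤ F)
    (hw : 0 < w) (hmono : ∀ i < n, x i ≤ x (i + 1))
    (hrateG : ∀ i < n, (t (i + 1) - t i) / r * (G - x i) ≤ x (i + 1) - x i)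
    (hrateF : ∀ i < n, (t (i + 1) - t i) / w * (F - x i) ≤ x (i + 1) - x i) :
    F - x n ≤ (F - G * (1 - Real.exp (-1))) * Real.exp (-((t n - r) / w)) := by
  classical
  have hex : ∃ k, r ≤ t k := ⟨n, hrn⟩
  obtain ⟨k, hk⟩ : ∃ k, Nat.find hex = k + 1 := by
    refine Nat.exists_eq_succ_of_ne_zero fun h => ?_
    have := Nat.find_spec hex
    rw [h, ht0] at this
    linarith
  have hk1 : r ≤ t (k + 1) := hk ▸ Nat.find_spec hex
  have hk0 : t k < r := not_le.1 (Nat.find_min hex (by omega))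
  have hkn : k + 1 ≤ n := hk ▸ Nat.find_min' hex hrn
  have hδ : 0 < t (k + 1) - t k := by linarith
  set δ := t (k + 1) - t k with hδdef
  set g := x (k + 1) - x k with hgdef
  have hg : 0 ≤ g := sub_nonneg.2 (hmono k (by omega))
  have hθ0 : 0 ≤ (r - t k) / δ := div_nonneg (by linarith) hδ.le
  have hθ1 : 0 ≤ (t (k + 1) - r) / δ := div_nonneg (by linarith) hδ.le
  have hθ : (r - t k) / δ + (t (k + 1) - r) / δ = 1 := by
    rw [← add_div, div_eq_one_iff_eq hδ.ne']; ring
  have h0 : G - x k ≤ G * Real.exp (-((t k - t 0) / r)) :=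
    sub_le_mul_exp_neg_of_rate k.zero_le hG (by simp [hx0])
      (fun i hi => hmono i (by omega)) (fun i hi => hrateG i (by omega))
  have h1 : G - (x k + (r - t k) / δ * g) ≤ G * Real.exp (-1) := by
    have := sub_le_mul_exp_neg_of_gain (a := (r - t k) / r) (g := (r - t k) / δ * g)
      (mul_nonneg hG (Real.exp_pos _).le) h0 (mul_nonneg hθ0 hg) (by
        refine le_trans (le_of_eq ?_) (mul_le_mul_of_nonneg_left (hrateG k (by omega)) hθ0)
        rw [← hδdef]
        field_simp)
    rw [mul_assoc, ← Real.exp_add, ht0] at this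
    convert this using 3
    field_simp
    ring
  have hY : 0 ≤ F - G * (1 - Real.exp (-1)) := by nlinarith [Real.exp_pos (-1)]
  have h2 : F - x (k + 1) ≤
      (F - G * (1 - Real.exp (-1))) * Real.exp (-((t (k + 1) - r) / w)) := by
    have := sub_le_mul_exp_neg_of_gain (F := F) (x := x k + (r - t k) / δ * g)
      (a := (t (k + 1) - r) / w) (g := (t (k + 1) - r) / δ * g) hY (by linarith)
      (mul_nonneg hθ1 hg) (by
        refine le_trans ?_ (mul_le_mul_of_nonneg_left (hrateF k (by omega)) hθ1)
        rw [← hδdef, ← mul_assoc]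
        have e : (t (k + 1) - r) / δ * (δ / w) = (t (k + 1) - r) / w := by field_simp
        rw [e]
        refine mul_le_mul_of_nonneg_left ?_ (div_nonneg (by linarith) hw.le)
        linarith [mul_nonneg hθ0 hg])
    convert this using 2
    linear_combination (-g) * hθ
  have h3 := sub_le_mul_exp_neg_of_rate (t := t) hkn (mul_nonneg hY (Real.exp_pos _).le) h2
    hmono hrateF
  rw [mul_assoc, ← Real.exp_add] at h3
  convert h3 using 3
  ring

/-! ### Marginal gains of submodular functions -/

section Submodular

variable {V : Type*} [DecidableEq V] {f : Finset V → ℝ}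

lemma le_add_sum_marginal (hmono : ∀ S T : Finset V, S ⊆ T → f S ≤ f T)
    (hsub : ∀ S T : Finset V, f (S ∪ T) + f (S ∩ T) ≤ f S + f T) (S W : Finset V) :
    f (S ∪ W) ≤ f S + ∑ v ∈ W, (f (insert v S) - f S) := by
  induction W using Finset.induction_on with
  | empty => simp
  | insert v W hv ih =>
    rw [sum_insert hv]
    have h := hsub (insert v S) (S ∪ W)
    have h1 : insert v S ∪ (S ∪ W) = S ∪ insert v W := by ext; simp
    have h2 := hmono S (insert v S ∩ (S ∪ W))
      (subset_inter (subset_insert _ _) subset_union_left)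
    rw [h1] at h
    linarith

lemma le_singleton_add_erase (hf0 : f ∅ = 0) (hmono : ∀ S T : Finset V, S ⊆ T → f S ≤ f T)
    (hsub : ∀ S T : Finset V, f (S ∪ T) + f (S ∩ T) ≤ f S + f T) (v : V) (W : Finset V) :
    f W ≤ f {v} + f (W.erase v) := by
  have h := hsub {v} (W.erase v)
  have h1 := hmono ∅ _ (empty_subset ({v} ∩ W.erase v))
  have h2 := hmono W ({v} ∪ W.erase v) fun x hx => by
    by_cases e : x = v <;> simp [e, hx]
  linarith

end Submodular

/-! ### Runs of the density greedy heuristic -/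

/-- A run of the greedy heuristic, indexed by natural numbers: `u i` is the `i`-th element
considered and `a i` the set accepted before considering it, for `i < N`. -/
structure IsGreedyRun {V : Type*} [DecidableEq V] (f : Finset V → ℝ) (c : V → ℝ) (b : ℝ) (N : ℕ)
    (u : ℕ → V) (a : ℕ → Finset V) : Prop where
  exists_index : ∀ v, ∃ i < N, u i = v
  zero : a 0 = ∅
  accept : ∀ i < N, ∑ v ∈ a i, c v + c (u i) ≤ b → a (i + 1) = insert (u i) (a i)
  reject : ∀ i < N, ¬ ∑ v ∈ a i, c v + c (u i) ≤ b → a (i + 1) = a i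
  greedy : ∀ i j, i ≤ j → j < N →
    (f (insert (u j) (a i)) - f (a i)) * c (u i) ≤ (f (insert (u i) (a i)) - f (a i)) * c (u j)

namespace IsGreedyRun

variable {V : Type*} [DecidableEq V] {f : Finset V → ℝ} {c : V → ℝ} {b : ℝ} {N : ℕ}
  {u : ℕ → V} {a : ℕ → Finset V}

lemma eq_or_eq_insert (h : IsGreedyRun f c b N u a) {i : ℕ} (hi : i < N) :
    a (i + 1) = a i ∨ a (i + 1) = insert (u i) (a i) := by
  by_cases hc : ∑ v ∈ a i, c v + c (u i) ≤ b
  · exact Or.inr (h.accept i hi hc)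
  · exact Or.inl (h.reject i hi hc)

lemma subset_succ (h : IsGreedyRun f c b N u a) {i : ℕ} (hi : i < N) : a i ⊆ a (i + 1) := by
  rcases h.eq_or_eq_insert hi with e | e
  · exact e.symm.subset
  · exact e ▸ subset_insert _ _

lemma subset_of_le (h : IsGreedyRun f c b N u a) {i j : ℕ} (hij : i ≤ j) (hj : j ≤ N) :
    a i ⊆ a j := by
  induction j, hij using Nat.le_induction with
  | base => exact Subset.rfl
  | succ j _ ih => exact (ih (by omega)).trans (h.subset_succ (by omega))

lemma subset_or_exists_reject (h : IsGreedyRun f c b N u a) (W : Finset V) :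
    W ⊆ a N ∨ ∃ k < N, u k ∈ W ∧ b < ∑ v ∈ a k, c v + c (u k) ∧
      ∀ i < k, u i ∈ W → u i ∈ a (i + 1) := by
  classical
  by_cases hW : W ⊆ a N
  · exact Or.inl hW
  obtain ⟨v, hv, hva⟩ := not_subset.1 hW
  obtain ⟨i, hi, rfl⟩ := h.exists_index v
  have hex : ∃ k, k < N ∧ u k ∈ W ∧ u k ∉ a (k + 1) :=
    ⟨i, hi, hv, fun hmem => hva (h.subset_of_le hi le_rfl hmem)⟩
  obtain ⟨hk, hkW, hka⟩ := Nat.find_spec hex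
  refine Or.inr ⟨Nat.find hex, hk, hkW, ?_, fun j hj hjW => ?_⟩
  · by_contra! hc
    exact hka (by rw [h.accept _ hk hc]; exact mem_insert_self _ _)
  · by_contra hja
    exact Nat.find_min hex hj ⟨hj.trans hk, hjW, hja⟩

lemma rate_le (h : IsGreedyRun f c b N u a) (hmono : ∀ S T : Finset V, S ⊆ T → f S ≤ f T)
    (hsub : ∀ S T : Finset V, f (S ∪ T) + f (S ∩ T) ≤ f S + f T) (hcpos : ∀ v, 0 < c v)
    {W : Finset V} {w : ℝ} (hw : 0 < w) (hW : ∑ v ∈ W, c v ≤ w) {k : ℕ} (hk : k ≤ N)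
    (hacc : ∀ i < k, u i ∈ W → u i ∈ a (i + 1)) {i : ℕ} (hi : i < k) :
    (∑ v ∈ a (i + 1), c v - ∑ v ∈ a i, c v) / w * (f W - f (a i)) ≤ f (a (i + 1)) - f (a i) := by
  by_cases heq : a (i + 1) = a i
  · simp [heq]
  have hins := (h.eq_or_eq_insert (hi.trans_le hk)).resolve_left heq
  have hui : u i ∉ a i := fun hm => heq (by rw [hins, insert_eq_of_mem hm])
  rw [hins, sum_insert hui, add_sub_cancel_right]
  set g := f (insert (u i) (a i)) - f (a i)
  have hg : 0 ≤ g := sub_nonneg.2 (hmono _ _ (subset_insert _ _))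
  have hci := hcpos (u i)
  have hsum : (f W - f (a i)) * c (u i) ≤ g * w := by
    have h1 := (hmono W (a i ∪ W) subset_union_right).trans
      (le_add_sum_marginal hmono hsub (a i) W)
    have h2 : (∑ v ∈ W, (f (insert v (a i)) - f (a i))) * c (u i) ≤ g * ∑ v ∈ W, c v := by
      rw [sum_mul, mul_sum]
      refine sum_le_sum fun v hv => ?_
      by_cases hva : v ∈ a i
      · rw [insert_eq_of_mem hva, sub_self, zero_mul]
        exact mul_nonneg hg (hcpos v).le
      obtain ⟨j, hj, rfl⟩ := h.exists_index v
      refine h.greedy i j (not_lt.1 fun hji => hva ?_) hj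
      exact h.subset_of_le (Nat.succ_le_of_lt hji) (by omega) (hacc j (by omega) hv)
    calc (f W - f (a i)) * c (u i)
        ≤ (∑ v ∈ W, (f (insert v (a i)) - f (a i))) * c (u i) :=
          mul_le_mul_of_nonneg_right (by linarith) hci.le
      _ ≤ g * ∑ v ∈ W, c v := h2
      _ ≤ g * w := mul_le_mul_of_nonneg_left hW hg
  rw [div_mul_eq_mul_div, div_le_iff₀ hw]
  linarith

lemma sub_le_mul_exp_neg (h : IsGreedyRun f c b N u a) (hf0 : f ∅ = 0)
    (hmono : ∀ S T : Finset V, S ⊆ T → f S ≤ f T)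
    (hsub : ∀ S T : Finset V, f (S ∪ T) + f (S ∩ T) ≤ f S + f T) (hcpos : ∀ v, 0 < c v)
    {W : Finset V} {w : ℝ} (hw : 0 < w) (hW : ∑ v ∈ W, c v ≤ w) {k : ℕ} (hk : k ≤ N)
    (hacc : ∀ i < k, u i ∈ W → u i ∈ a (i + 1)) :
    f W - f (a k) ≤ f W * Real.exp (-((∑ v ∈ a k, c v) / w)) := by
  have hfW : 0 ≤ f W := hf0 ▸ hmono ∅ W (empty_subset _)
  have := sub_le_mul_exp_neg_of_rate (x := fun i => f (a i)) (t := fun i => ∑ v ∈ a i, c v)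
    k.zero_le hfW (by simp [h.zero, hf0])
    (fun i hi => hmono _ _ (h.subset_succ (hi.trans_le hk)))
    (fun i hi => h.rate_le hmono hsub hcpos hw hW hk hacc hi)
  simpa [h.zero] using this

end IsGreedyRun

/-! ### Numerical estimates -/

lemma exp_neg_lt_of_taylor {x y : ℝ} (hx : 0 ≤ x) (hy : 0 < y) (n : ℕ)
    (h : y⁻¹ < ∑ i ∈ range n, x ^ i / i.factorial) : Real.exp (-x) < y := by
  rw [Real.exp_neg]
  exact inv_lt_of_inv_lt₀ hy (h.trans_le (Real.sum_le_exp_of_nonneg hx n))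

lemma exp_neg_521_lt : Real.exp (-0.521) < 0.594 :=
  exp_neg_lt_of_taylor (by norm_num) (by norm_num) 8
    (by norm_num [sum_range_succ, Nat.factorial])

lemma exp_neg_1151_lt : Real.exp (-1.151) < 0.188 / 0.594 :=
  exp_neg_lt_of_taylor (by norm_num) (by norm_num) 10
    (by norm_num [sum_range_succ, Nat.factorial])

lemma exp_neg_400_lt : Real.exp (-0.4) < 0.6704 :=
  exp_neg_lt_of_taylor (by norm_num) (by norm_num) 8
    (by norm_num [sum_range_succ, Nat.factorial])

lemma log_594_lt : Real.log 0.594 < -0.52 := by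
  rw [Real.log_lt_iff_lt_exp (by norm_num), Real.exp_neg]
  refine lt_inv_of_lt_inv₀ (Real.exp_pos _) ?_
  refine (Real.exp_bound' (n := 8) (by norm_num) (by norm_num) (by norm_num)).trans_lt ?_
  norm_num [sum_range_succ, Nat.factorial]

lemma root_le {α : ℝ} (hα : α < 1)
    (hroot : (1 - α) * Real.log (1 - α) + (2 - 1 / Real.exp 1) * (1 - 2 * α) = 0) :
    α ≤ 0.406 := by
  by_contra! h
  have hlog : Real.log (1 - α) < -0.52 :=
    (Real.log_lt_log (by linarith) (by linarith)).trans log_594_lt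
  have he : 0.3678 < 1 / Real.exp 1 := by
    rw [lt_div_iff₀ (Real.exp_pos _)]
    linarith [Real.exp_one_lt_d9]
  have he' : 1 / Real.exp 1 < 1 := by
    rw [div_lt_one (Real.exp_pos _)]
    linarith [Real.exp_one_gt_d9]
  have h1 : (1 - α) * Real.log (1 - α) < (1 - α) * -0.52 :=
    mul_lt_mul_of_pos_left hlog (by linarith)
  rcases le_total α (1 / 2) with h2 | h2
  · have : (2 - 1 / Real.exp 1) * (1 - 2 * α) ≤ 1.6322 * (1 - 2 * α) :=
      mul_le_mul_of_nonneg_right (by linarith) (by linarith)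
    linarith
  · have : (2 - 1 / Real.exp 1) * (1 - 2 * α) ≤ 0 :=
      mul_nonpos_of_nonneg_of_nonpos (by linarith) (by linarith)
    linarith

/-- The numerical inequalities available after two rejections are incompatible with all values
being below `0.406` times the optimum. -/
lemma false_of_two_rejections {F G H x₁ x₂ t₁ t₂ r b c₁ c₂ : ℝ} (hF : 0 < F) (hb : 0 < b)
    (hw : 0 < b - c₁) (hcost : r + c₁ + c₂ ≤ b) (ht₁ : b < t₁ + c₁) (ht₂ : b < t₂ + c₂)
    (hG : 0.594 * F ≤ G) (hH : 0.188 * F ≤ H)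
    (hx₁ : x₁ ≤ 0.406 * F) (hx₂ : x₂ ≤ 0.406 * F)
    (h₁ : F - x₁ ≤ F * Real.exp (-(t₁ / b)))
    (h₂ : G - x₂ ≤ G * Real.exp (-(t₂ / (b - c₁))))
    (h₃ : F - x₁ ≤ (F - H * (1 - Real.exp (-1))) * Real.exp (-((t₁ - r) / b))) : False := by
  have hp : t₁ / b < 0.521 := by
    by_contra! h
    have := (Real.exp_le_exp.2 (neg_le_neg h)).trans_lt exp_neg_521_lt
    nlinarith
  have hq : t₂ / (b - c₁) < 1.151 := by
    by_contra! h
    have := (Real.exp_le_exp.2 (neg_le_neg h)).trans_lt exp_neg_1151_lt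
    have hGpos : 0 < G := by linarith
    have h5 : G * Real.exp (-(t₂ / (b - c₁))) < G * (0.188 / 0.594) :=
      mul_lt_mul_of_pos_left this hGpos
    linarith
  rw [div_lt_iff₀ hb] at hp
  rw [div_lt_iff₀ hw] at hq
  have hr : 0.4 ≤ (t₁ - r) / b := by
    rw [le_div_iff₀ hb]
    linarith
  have he := (Real.exp_le_exp.2 (neg_le_neg hr)).trans_lt exp_neg_400_lt
  have he1 : Real.exp (-1) < 0.3679 := by linarith [Real.exp_neg_one_lt_d9]
  have hY : F - H * (1 - Real.exp (-1)) ≤ 0.8812 * F := by nlinarith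
  have h6 : (F - H * (1 - Real.exp (-1))) * Real.exp (-((t₁ - r) / b)) ≤ 0.8812 * F * 0.6704 :=
    mul_le_mul hY he.le (Real.exp_pos _).le (by linarith)
  linarith

namespace IsGreedyRun

variable {V : Type*} [DecidableEq V] {f : Finset V → ℝ} {c : V → ℝ} {b : ℝ} {N : ℕ}
  {u : ℕ → V} {a : ℕ → Finset V}

/-- If every singleton has value at most `0.406 * f OPT`, the greedy set has value at least
`0.406 * f OPT`. -/
theorem le_greedy_of_singleton_le (h : IsGreedyRun f c b N u a) (hf0 : f ∅ = 0)
    (hmono : ∀ S T : Finset V, S ⊆ T → f S ≤ f T)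
    (hsub : ∀ S T : Finset V, f (S ∪ T) + f (S ∩ T) ≤ f S + f T) (hcpos : ∀ v, 0 < c v)
    (hb : 0 < b) {OPT : Finset V} (hOPT : ∑ v ∈ OPT, c v ≤ b)
    (hsing : ∀ v, f {v} ≤ 0.406 * f OPT) : 0.406 * f OPT ≤ f (a N) := by
  have hnn : ∀ S, 0 ≤ f S := fun S => hf0 ▸ hmono ∅ S (empty_subset _)
  rcases (hnn OPT).eq_or_lt with hF | hF
  · simpa [← hF] using hnn (a N)
  by_contra! hlt
  rcases h.subset_or_exists_reject OPT with hs | ⟨k, hk, hkO, hkb, hkacc⟩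
  · linarith [hmono _ _ hs]
  have hG := le_singleton_add_erase hf0 hmono hsub (u k) OPT
  have hGs := hsing (u k)
  rcases h.subset_or_exists_reject (OPT.erase (u k)) with hs | ⟨l, hl, hlO, hlb, hlacc⟩
  · linarith [hmono _ _ hs]
  have hH := le_singleton_add_erase hf0 hmono hsub (u l) (OPT.erase (u k))
  have hHs := hsing (u l)
  have hc1 := add_sum_erase OPT c hkO
  have hc2 := add_sum_erase (OPT.erase (u k)) c hlO
  set R := (OPT.erase (u k)).erase (u l) with hR
  have hRO : R ⊆ OPT := (erase_subset _ _).trans (erase_subset _ _)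
  have hRpos : 0 < ∑ v ∈ R, c v := by
    refine sum_pos (fun v _ => hcpos v) (nonempty_iff_ne_empty.2 fun h0 => ?_)
    rw [h0, hf0] at hH
    linarith
  have hul := hcpos (u l)
  have hw : 0 < b - c (u k) := by linarith
  have hxk := hmono _ _ (h.subset_of_le hk.le le_rfl)
  have hxl := hmono _ _ (h.subset_of_le hl.le le_rfl)
  have h₁ := h.sub_le_mul_exp_neg hf0 hmono hsub hcpos hb hOPT hk.le hkacc
  have h₂ := h.sub_le_mul_exp_neg hf0 hmono hsub hcpos hw (by linarith) hl.le hlacc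
  have h₃ := sub_le_mul_exp_neg_of_two_rates (x := fun i => f (a i))
    (t := fun i => ∑ v ∈ a i, c v) (n := k) (by simp [h.zero, hf0]) (by simp [h.zero]) hRpos
    (by linarith) (hnn R) (hmono _ _ hRO) hb
    (fun i hi => hmono _ _ (h.subset_succ (hi.trans hk)))
    (fun i hi => h.rate_le hmono hsub hcpos hRpos le_rfl hk.le
      (fun j hj hjR => hkacc j hj (hRO hjR)) hi)
    (fun i hi => h.rate_le hmono hsub hcpos hb hOPT hk.le hkacc hi)
  exact false_of_two_rejections hF hb hw (by linarith) hkb hlb (by linarith) (by linarith)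
    (by linarith) (by linarith) h₁ h₂ h₃

lemma of_fin {u : Fin N → V} {A : Fin (N + 1) → Finset V} (hN : 0 < N)
    (hu : Function.Surjective u) (hA0 : A 0 = ∅)
    (hstep : ∀ i : Fin N,
      ((∑ v ∈ A i.castSucc, c v) + c (u i) ≤ b → A i.succ = insert (u i) (A i.castSucc)) ∧
      (¬ ((∑ v ∈ A i.castSucc, c v) + c (u i) ≤ b) → A i.succ = A i.castSucc))
    (hgreedy : ∀ i j : Fin N, i ≤ j →
      (f (insert (u i) (A i.castSucc)) - f (A i.castSucc)) * c (u j) ≥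
      (f (insert (u j) (A i.castSucc)) - f (A i.castSucc)) * c (u i)) :
    IsGreedyRun f c b N (fun i => if h : i < N then u ⟨i, h⟩ else u ⟨0, hN⟩)
      (fun i => A ⟨min i N, by omega⟩) := by
  have hcast : ∀ i (hi : i < N), (⟨min i N, by omega⟩ : Fin (N + 1)) = Fin.castSucc ⟨i, hi⟩ :=
    fun i hi => Fin.ext (min_eq_left hi.le)
  have hsucc : ∀ i (hi : i < N), (⟨min (i + 1) N, by omega⟩ : Fin (N + 1)) = Fin.succ ⟨i, hi⟩ :=
    fun i hi => Fin.ext (min_eq_left hi)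
  refine ⟨fun v => ?_, ?_, fun i hi hc => ?_, fun i hi hc => ?_, fun i j hij hj => ?_⟩
  · obtain ⟨i, rfl⟩ := hu v
    exact ⟨i, i.2, by simp⟩
  · simpa using hA0
  · simp only [hcast i hi, hsucc i hi, dif_pos hi] at hc ⊢
    exact (hstep ⟨i, hi⟩).1 hc
  · simp only [hcast i hi, hsucc i hi, dif_pos hi] at hc ⊢
    exact (hstep ⟨i, hi⟩).2 hc
  · have hi := hij.trans_lt hj
    simp only [hcast i hi, dif_pos hi, dif_pos hj]
    exact hgreedy ⟨i, hi⟩ ⟨j, hj⟩ hij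

end IsGreedyRun

/-- Theorem 1 (main approximation guarantee of the modified greedy algorithm):
for every run of MGreedy, every feasible OPT, and every root α⊥ ∈ (0.405, 1) of
(1−α)·ln(1−α) + (2 − 1/e)·(1 − 2α) = 0, we have f(S_m) ≥ α⊥ · f(OPT). -/
theorem stmt1 {V : Type*} [Fintype V] [DecidableEq V] [Nonempty V]
    (f : Finset V → ℝ) (c : V → ℝ) (b : ℝ)
    (hf0 : f ∅ = 0)
    (hmono : ∀ S T : Finset V, S ⊆ T → f S ≤ f T)
    (hsub : ∀ S T : Finset V, f (S ∪ T) + f (S ∩ T) ≤ f S + f T)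
    (hcpos : ∀ v : V, 0 < c v)
    (hb : 0 < b)
    (hcb : ∀ v : V, c v ≤ b)
    (u : Fin (Fintype.card V) → V) (hu : Function.Bijective u)
    (A : Fin (Fintype.card V + 1) → Finset V)
    (hA0 : A 0 = ∅)
    (hstep : ∀ i : Fin (Fintype.card V),
      ((∑ v ∈ A i.castSucc, c v) + c (u i) ≤ b →
        A i.succ = insert (u i) (A i.castSucc)) ∧
      (¬ ((∑ v ∈ A i.castSucc, c v) + c (u i) ≤ b) →
        A i.succ = A i.castSucc))
    (hgreedy : ∀ i j : Fin (Fintype.card V), i ≤ j →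
      (f (insert (u i) (A i.castSucc)) - f (A i.castSucc)) * c (u j) ≥
      (f (insert (u j) (A i.castSucc)) - f (A i.castSucc)) * c (u i))
    (OPT : Finset V) (hOPT : ∑ v ∈ OPT, c v ≤ b)
    (α : ℝ) (hα1 : 0.405 < α) (hα2 : α < 1)
    (hαroot : (1 - α) * Real.log (1 - α) + (2 - 1 / Real.exp 1) * (1 - 2 * α) = 0) :
    max (f (A (Fin.last (Fintype.card V))))
      (Finset.univ.sup' Finset.univ_nonempty fun v : V => f {v}) ≥ α * f OPT := by
  have hrun := IsGreedyRun.of_fin Fintype.card_pos hu.2 hA0 hstep hgreedy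
  have hlast : (⟨min (Fintype.card V) (Fintype.card V), by omega⟩ : Fin (Fintype.card V + 1)) =
      Fin.last _ := Fin.ext (min_self _)
  have hF : 0 ≤ f OPT := hf0 ▸ hmono ∅ OPT (empty_subset _)
  have hα : α * f OPT ≤ 0.406 * f OPT := mul_le_mul_of_nonneg_right (root_le hα2 hαroot) hF
  refine hα.trans ?_
  by_cases hsing : ∀ v, f {v} ≤ 0.406 * f OPT
  · have := hrun.le_greedy_of_singleton_le hf0 hmono hsub hcpos hb hOPT hsing
    rw [hlast] at this
    exact this.trans (le_max_left _ _)
  · push Not at hsing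
    obtain ⟨v, hv⟩ := hsing
    exact (hv.le.trans (le_sup' (fun v => f {v}) (mem_univ v))).trans (le_max_right _ _)
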